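/- arXiv:2111.14167 — 4 statements merged into one kernel-verified Lean document; each statement's English description precedes it below -/
import Mathlib

section
/- For every temperature T > 0, the Planck function integrates over all frequencies to the Stefan–Boltzmann law: ∫₀^∞ B_ν(T) dν = σ̄ T⁴, where σ̄ = 2π⁴k⁴/(15 c² ħ³). -/
open MeasureTheory Real

lemma integral_pow_three_mul_exp_neg_mul_Ioi {r : ℝ} (hr : 0 < r) :
    ∫ t in Set.Ioi (0 : ℝ), t ^ 3 * Real.exp (-(r * t)) = 6 / r ^ 4 := by
  have h := Real.integral_rpow_mul_exp_neg_mul_Ioi (a := 4) (by norm_num) hr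
  have hG : Real.Gamma 4 = 6 := by
    rw [show (4 : ℝ) = (3 : ℕ) + 1 by norm_num, Real.Gamma_nat_eq_factorial]
    norm_num [Nat.factorial]
  have h3 : (4 : ℝ) - 1 = (3 : ℕ) := by norm_num
  have h4 : (4 : ℝ) = (4 : ℕ) := by norm_num
  rw [hG, h3] at h
  simp only [Real.rpow_natCast] at h
  rw [h, h4, Real.rpow_natCast]
  field_simp

lemma integrableOn_pow_three_mul_exp_neg_mul_Ioi {r : ℝ} (hr : 0 < r) :
    IntegrableOn (fun t : ℝ => t ^ 3 * Real.exp (-(r * t))) (Set.Ioi 0) := by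
  by_contra h
  have h0 := integral_undef h
  rw [integral_pow_three_mul_exp_neg_mul_Ioi hr] at h0
  exact (by positivity : (6 : ℝ) / r ^ 4 ≠ 0) h0

lemma hasSum_pow_three_mul_exp_neg {a t : ℝ} (hat : 0 < a * t) :
    HasSum (fun n : ℕ => t ^ 3 * Real.exp (-((a * (n + 1)) * t)))
      (t ^ 3 / (Real.exp (a * t) - 1)) := by
  have hlt : Real.exp (-(a * t)) < 1 := by rw [Real.exp_lt_one_iff]; linarith
  have hgt : 1 < Real.exp (a * t) := by rwa [Real.one_lt_exp_iff]
  have h := (hasSum_geometric_of_lt_one (Real.exp_pos _).le hlt).mul_left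
    (t ^ 3 * Real.exp (-(a * t)))
  convert! h using 1
  · funext n
    rw [mul_assoc (t ^ 3), ← Real.exp_nat_mul, ← Real.exp_add]
    congr 2
    ring
  · have h1 : Real.exp (a * t) - 1 ≠ 0 := by linarith
    rw [Real.exp_neg]
    field_simp

/-- The Bose–Einstein integral of order four. -/
lemma integral_pow_three_div_exp_mul_sub_one_Ioi {a : ℝ} (ha : 0 < a) :
    ∫ t in Set.Ioi (0 : ℝ), t ^ 3 / (Real.exp (a * t) - 1) = π ^ 4 / (15 * a ^ 4) := by
  have hr (n : ℕ) : 0 < a * ((n : ℝ) + 1) := by positivity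
  have hz : HasSum (fun n : ℕ => 6 / (a * ((n : ℝ) + 1)) ^ 4) (π ^ 4 / (15 * a ^ 4)) := by
    have h := ((hasSum_nat_add_iff' 1).mpr hasSum_zeta_four).mul_left (6 / a ^ 4)
    convert! h using 1
    · funext n
      push_cast
      field_simp
    · simp
      field_simp
      norm_num
  have hnorm (n : ℕ) : ∫ t in Set.Ioi (0 : ℝ), ‖t ^ 3 * Real.exp (-((a * (n + 1)) * t))‖
      = 6 / (a * ((n : ℝ) + 1)) ^ 4 := by
    rw [← integral_pow_three_mul_exp_neg_mul_Ioi (hr n)]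
    refine setIntegral_congr_fun measurableSet_Ioi fun t ht => ?_
    have ht : 0 < t := ht
    exact Real.norm_of_nonneg (by positivity)
  have key := hasSum_integral_of_summable_integral_norm
    (fun n : ℕ => integrableOn_pow_three_mul_exp_neg_mul_Ioi (hr n))
    (by simpa only [hnorm] using hz.summable)
  simp only [integral_pow_three_mul_exp_neg_mul_Ioi (hr _)] at key
  rw [← key.unique hz]
  refine setIntegral_congr_fun measurableSet_Ioi fun t ht => ?_
  exact (hasSum_pow_three_mul_exp_neg (mul_pos ha ht)).tsum_eq.symm

/-- **Stefan–Boltzmann identity.**  For positive physical constants `hbar` (Planck constant),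
`kB` (Boltzmann constant), `c` (speed of light) and every temperature `T > 0`, the Planck
function `B_ν(T) = 2·hbar·ν³ / (c² (exp(hbar·ν/(kB·T)) − 1))` integrates over all frequencies
`ν ∈ (0,∞)` to `σ̄ T⁴` with `σ̄ = 2π⁴kB⁴/(15 c² hbar³)`. -/
theorem stefan_boltzmann_identity
    (hbar kB c : ℝ) (hhbar : 0 < hbar) (hkB : 0 < kB) (hc : 0 < c)
    (T : ℝ) (hT : 0 < T) :
    ∫ ν in Set.Ioi (0 : ℝ),
        2 * hbar * ν ^ 3 / (c ^ 2 * (Real.exp (hbar * ν / (kB * T)) - 1))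
      = (2 * Real.pi ^ 4 * kB ^ 4 / (15 * c ^ 2 * hbar ^ 3)) * T ^ 4 := by
  have ha : 0 < hbar / (kB * T) := by positivity
  calc _ = ∫ ν in Set.Ioi (0 : ℝ),
        2 * hbar / c ^ 2 * (ν ^ 3 / (Real.exp (hbar / (kB * T) * ν) - 1)) := by
        congr 1
        funext ν
        rw [div_mul_div_comm, div_mul_eq_mul_div]
    _ = _ := by
        rw [integral_const_mul, integral_pow_three_div_exp_mul_sub_one_Ioi ha]
        field_simp
end

section
/- For every T > 0, one may differentiate the Stefan–Boltzmann identity under the integral sign: ∫₀^∞ ∂_T B_ν(T) dν = 4 σ̄ T³, where σ̄ = 2π⁴k⁴/(15 c² ħ³). Equivalently, writing Φ = σ̄T⁴ and b_ν(Φ) = B_ν(T), one has ∫₀^∞ ∂_Φ b_ν(Φ) dν = 1. -/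
open MeasureTheory Real

theorem integrableOn_pow_mul_exp_neg_mul_Ioi (m : ℕ) {b : ℝ} (hb : 0 < b) :
    IntegrableOn (fun x : ℝ => x ^ m * exp (-(b * x))) (Set.Ioi 0) := by
  have h := integrableOn_rpow_mul_exp_neg_mul_rpow (p := 1) (s := m) (b := b)
    (neg_one_lt_zero.trans_le m.cast_nonneg) one_pos hb
  simpa using h

theorem integral_pow_mul_exp_neg_mul_Ioi (m : ℕ) {b : ℝ} (hb : 0 < b) :
    ∫ x in Set.Ioi (0 : ℝ), x ^ m * exp (-(b * x)) = m.factorial / b ^ (m + 1) := by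
  have h := integral_rpow_mul_exp_neg_mul_Ioi (a := (m : ℝ) + 1) (r := b) (by positivity) hb
  rw [Gamma_nat_eq_factorial, ← Nat.cast_succ, rpow_natCast] at h
  simp only [Nat.cast_succ, add_sub_cancel_right, rpow_natCast] at h
  rw [h]
  simp [div_eq_mul_inv, mul_comm]

/-- The integrand is the termwise sum of `n * x ^ 4 * exp (-n * x)`. -/
theorem integral_pow_four_mul_exp_div_exp_sub_one_sq :
    ∫ x in Set.Ioi (0 : ℝ), x ^ 4 * exp x / (exp x - 1) ^ 2 = 4 * π ^ 4 / 15 := by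
  have hint (n : ℕ) : IntegrableOn (fun x : ℝ => n * (x ^ 4 * exp (-(n * x)))) (Set.Ioi 0) := by
    rcases n.eq_zero_or_pos with rfl | hn
    · simp
    · exact (integrableOn_pow_mul_exp_neg_mul_Ioi 4 (Nat.cast_pos.2 hn)).const_mul _
  have hval (n : ℕ) : ∫ x in Set.Ioi (0 : ℝ), n * (x ^ 4 * exp (-(n * x))) =
      24 * (1 / (n : ℝ) ^ 4) := by
    rcases n.eq_zero_or_pos with rfl | hn
    · simp
    · have hn' : (n : ℝ) ≠ 0 := by positivity
      rw [integral_const_mul, integral_pow_mul_exp_neg_mul_Ioi 4 (Nat.cast_pos.2 hn)]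
      simp only [Nat.factorial]
      push_cast
      field_simp
  have hnorm (n : ℕ) : ∫ x in Set.Ioi (0 : ℝ), ‖n * (x ^ 4 * exp (-(n * x)))‖ =
      24 * (1 / (n : ℝ) ^ 4) := by
    rw [← hval]
    congr 1 with x
    exact norm_of_nonneg (by positivity)
  have hzeta := hasSum_zeta_four.mul_left 24
  have hsum := hasSum_integral_of_summable_integral_norm hint
    (by simp only [hnorm]; exact hzeta.summable)
  simp only [hval] at hsum
  calc ∫ x in Set.Ioi (0 : ℝ), x ^ 4 * exp x / (exp x - 1) ^ 2
      = ∫ x in Set.Ioi (0 : ℝ), ∑' n : ℕ, n * (x ^ 4 * exp (-(n * x))) := by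
        refine setIntegral_congr_fun measurableSet_Ioi fun x hx => ?_
        have hx : 0 < x := hx
        have hlt : ‖exp (-x)‖ < 1 := by
          rw [norm_of_nonneg (exp_pos _).le]
          simpa using hx
        have h := (hasSum_coe_mul_geometric_of_norm_lt_one hlt).mul_left (x ^ 4)
        have hterm : (fun n : ℕ => x ^ 4 * (n * exp (-x) ^ n)) =
            fun n : ℕ => n * (x ^ 4 * exp (-(n * x))) := by
          ext n
          rw [← exp_nat_mul, mul_neg]
          ring
        rw [hterm] at h
        rw [h.tsum_eq, exp_neg]
        have h1 : exp x - 1 ≠ 0 := (sub_pos.2 (one_lt_exp_iff.2 hx)).ne'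
        have h2 := (exp_pos x).ne'
        field_simp
    _ = 4 * π ^ 4 / 15 := by
        rw [hsum.unique hzeta]
        ring

theorem hasDerivAt_planck {hbar kB c ν T : ℝ} (hhbar : 0 < hbar) (hkB : 0 < kB) (hc : 0 < c)
    (hν : 0 < ν) (hT : 0 < T) :
    HasDerivAt (fun T : ℝ => 2 * hbar * ν ^ 3 / (c ^ 2 * (exp (hbar * ν / (kB * T)) - 1)))
      (2 * kB ^ 3 * T ^ 2 / (c ^ 2 * hbar ^ 2) *
        ((hbar / (kB * T) * ν) ^ 4 * exp (hbar / (kB * T) * ν) /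
          (exp (hbar / (kB * T) * ν) - 1) ^ 2)) T := by
  have hy : 0 < hbar * ν / (kB * T) := by positivity
  have h1 : exp (hbar * ν / (kB * T)) - 1 ≠ 0 := (sub_pos.2 (one_lt_exp_iff.2 hy)).ne'
  have h := (((((hasDerivAt_id T).const_mul kB).fun_inv (mul_pos hkB hT).ne').const_mul
    (hbar * ν)).exp.sub_const 1).const_mul (c ^ 2)
  have h' := (h.fun_inv (mul_ne_zero (by positivity)
    (by simpa [div_eq_mul_inv] using h1))).const_mul (2 * hbar * ν ^ 3)
  simp only [id, ← div_eq_mul_inv] at h'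
  refine h'.congr_deriv ?_
  rw [div_mul_eq_mul_div hbar]
  generalize exp (hbar * ν / (kB * T)) = E at *
  field_simp

theorem integral_deriv_planck {hbar kB c T : ℝ} (hhbar : 0 < hbar) (hkB : 0 < kB) (hT : 0 < T) :
    ∫ ν in Set.Ioi (0 : ℝ), 2 * kB ^ 3 * T ^ 2 / (c ^ 2 * hbar ^ 2) *
        ((hbar / (kB * T) * ν) ^ 4 * exp (hbar / (kB * T) * ν) /
          (exp (hbar / (kB * T) * ν) - 1) ^ 2) =
      4 * (2 * π ^ 4 * kB ^ 4 / (15 * c ^ 2 * hbar ^ 3)) * T ^ 3 := by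
  rw [integral_const_mul, integral_comp_mul_left_Ioi
    (fun x => x ^ 4 * exp x / (exp x - 1) ^ 2) 0 (by positivity : 0 < hbar / (kB * T)),
    mul_zero, integral_pow_four_mul_exp_div_exp_sub_one_sq, smul_eq_mul]
  field_simp

/-- Differentiating the Stefan–Boltzmann identity under the integral sign: for every `T > 0`,
`∫₀^∞ ∂_T B_ν(T) dν = 4σ̄T³` where `B_ν(T) = 2·hbar·ν³ / (c² (exp(hbar·ν/(kB·T)) − 1))` and
`σ̄ = 2π⁴kB⁴/(15c²hbar³)`.  Equivalently, writing `Φ = σ̄T⁴` and `b_ν(Φ) = B_ν(T)`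
(i.e. `b_ν(Φ) = B_ν((Φ/σ̄)^{1/4})`), one has `∫₀^∞ ∂_Φ b_ν(Φ) dν = 1`. -/
theorem planck_deriv_integral
    (hbar kB c : ℝ) (hhbar : 0 < hbar) (hkB : 0 < kB) (hc : 0 < c)
    (B : ℝ → ℝ → ℝ)
    (hB : ∀ ν T, B ν T = 2 * hbar * ν ^ 3 / (c ^ 2 * (Real.exp (hbar * ν / (kB * T)) - 1)))
    (σ : ℝ) (hσ : σ = 2 * Real.pi ^ 4 * kB ^ 4 / (15 * c ^ 2 * hbar ^ 3))
    (T : ℝ) (hT : 0 < T) :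
    (∫ ν in Set.Ioi (0 : ℝ), deriv (fun T' : ℝ => B ν T') T = 4 * σ * T ^ 3)
    ∧
    (∫ ν in Set.Ioi (0 : ℝ),
        deriv (fun Φ : ℝ => B ν ((Φ / σ) ^ ((1 : ℝ) / 4))) (σ * T ^ 4) = 1) := by
  have hσ0 : 0 < σ := by rw [hσ]; positivity
  have hBT : ∀ ν, 0 < ν → HasDerivAt (B ν) _ T := fun ν hν => by
    rw [funext (hB ν)]
    exact hasDerivAt_planck hhbar hkB hc hν hT
  have hint := integral_deriv_planck (c := c) hhbar hkB hT
  rw [← hσ] at hint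
  constructor
  · rw [← hint]
    exact setIntegral_congr_fun measurableSet_Ioi fun ν hν => (hBT ν hν).deriv
  · have hroot : (σ * T ^ 4 / σ) ^ ((1 : ℝ) / 4) = T := by
      rw [mul_div_cancel_left₀ _ hσ0.ne', ← rpow_natCast, ← rpow_mul hT.le]
      norm_num
    have hΦ : HasDerivAt (fun Φ : ℝ => (Φ / σ) ^ ((1 : ℝ) / 4)) (1 / (4 * σ * T ^ 3))
        (σ * T ^ 4) := by
      have h := ((hasDerivAt_id (σ * T ^ 4)).div_const σ).rpow_const (p := (1 : ℝ) / 4)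
        (Or.inl (by simp only [id]; positivity))
      refine h.congr_deriv ?_
      simp only [id]
      rw [rpow_sub_one (by positivity), hroot]
      field_simp
    have hcomp : ∀ ν ∈ Set.Ioi (0 : ℝ),
        deriv (fun Φ : ℝ => B ν ((Φ / σ) ^ ((1 : ℝ) / 4))) (σ * T ^ 4) = _ := fun ν hν =>
      ((hBT ν hν).comp_of_eq (σ * T ^ 4) hΦ hroot.symm).deriv
    rw [setIntegral_congr_fun measurableSet_Ioi hcomp, integral_mul_const, hint]
    field_simp
end

section
/- For every t > 0, the exponential integral E₁ admits the convergent series expansion E₁(t) = −γ − log t + Σ_{k=1}^∞ (−1)^{k+1} t^k / (k · k!), where γ is the Euler–Mascheroni constant. -/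
open MeasureTheory Real

/-- The exponential integral `E_p(X) = ∫₀¹ e^{−X/μ} μ^{p−2} dμ` (for `X > 0`, integer
`p ≥ 1`); in particular `E₁(t) = ∫₀¹ e^{−t/μ} μ^{−1} dμ`. -/
noncomputable def expInt (p : ℕ) (X : ℝ) : ℝ :=
  ∫ μ in Set.Ioo (0 : ℝ) 1, Real.exp (-X / μ) * μ ^ ((p : ℝ) - 2)

open Set Filter Topology

lemma integral_Ioi_log_mul_exp_neg :
    ∫ u in Ioi (0 : ℝ), Real.log u * Real.exp (-u) = -Real.eulerMascheroniConstant := by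
  have hGamma : HasDerivAt Complex.GammaIntegral (-(Real.eulerMascheroniConstant : ℂ)) 1 := by
    refine Complex.hasDerivAt_Gamma_one.congr_of_eventuallyEq ?_
    filter_upwards [(isOpen_lt continuous_const Complex.continuous_re).mem_nhds
      (show (0 : ℝ) < (1 : ℂ).re by simp)] with s hs
    exact (Complex.Gamma_eq_integral hs).symm
  have h := (Complex.hasDerivAt_GammaIntegral (s := 1) (by simp)).unique hGamma
  simp only [sub_self, Complex.cpow_zero, one_mul] at h
  simp only [← Complex.ofReal_mul] at h
  rw [integral_complex_ofReal] at h
  exact_mod_cast h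

lemma integrableOn_Ioi_log_mul_exp_neg :
    IntegrableOn (fun u : ℝ => Real.log u * Real.exp (-u)) (Ioi 0) := by
  by_contra h
  have := integral_Ioi_log_mul_exp_neg
  rw [integral_undef h] at this
  linarith [Real.one_half_lt_eulerMascheroniConstant]

lemma expInt_one_eq_integral_Ioi {t : ℝ} (ht : 0 < t) :
    expInt 1 t = ∫ u in Ioi t, Real.exp (-u) / u := by
  have himage : (fun u : ℝ => t / u) '' Ioi t = Ioo 0 1 := by
    ext x
    constructor
    · rintro ⟨u, hu, rfl⟩
      have hu' : t < u := hu
      exact ⟨div_pos ht (ht.trans hu'), (div_lt_one (ht.trans hu')).2 hu'⟩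
    · rintro ⟨hx0, hx1⟩
      refine ⟨t / x, ?_, by field_simp⟩
      rw [mem_Ioi, lt_div_iff₀ hx0]
      nlinarith
  have hderiv : ∀ u ∈ Ioi t,
      HasDerivWithinAt (fun u : ℝ => t / u) (-t / u ^ 2) (Ioi t) u := by
    intro u hu
    have hu0 : u ≠ 0 := (ht.trans hu).ne'
    refine (((hasDerivAt_const u t).div (hasDerivAt_id u) hu0).congr_deriv ?_).hasDerivWithinAt
    simp
  have hinj : InjOn (fun u : ℝ => t / u) (Ioi t) := by
    intro u hu v hv huv
    have hu0 : u ≠ 0 := (ht.trans hu).ne'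
    have hv0 : v ≠ 0 := (ht.trans hv).ne'
    have huv' : t / u = t / v := huv
    field_simp at huv'
    exact huv'.symm
  rw [expInt, ← himage,
    integral_image_eq_integral_abs_deriv_smul measurableSet_Ioi hderiv hinj]
  refine setIntegral_congr_fun measurableSet_Ioi fun u hu => ?_
  have hu0 : 0 < u := ht.trans hu
  have hexp : ((1 : ℕ) : ℝ) - 2 = -1 := by norm_num
  simp only [smul_eq_mul, hexp, Real.rpow_neg_one]
  rw [abs_div, abs_neg, abs_of_pos ht, abs_of_pos (pow_pos hu0 2),
    show -t / (t / u) = -u by field_simp]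
  field_simp

lemma integral_Ioi_exp_neg_div {t : ℝ} (ht : 0 < t) :
    ∫ u in Ioi t, Real.exp (-u) / u =
      (∫ u in Ioi t, Real.log u * Real.exp (-u)) - Real.log t * Real.exp (-t) := by
  have hlog : IntegrableOn (fun u : ℝ => Real.log u * Real.exp (-u)) (Ioi t) :=
    integrableOn_Ioi_log_mul_exp_neg.mono_set (Ioi_subset_Ioi ht.le)
  have hdiv : IntegrableOn (fun u : ℝ => Real.exp (-u) / u) (Ioi t) := by
    refine ((integrableOn_exp_neg_Ioi t).div_const t).mono' ?_ ?_
    · exact (by fun_prop : Measurable fun u : ℝ => Real.exp (-u) / u).aestronglyMeasurable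
    · filter_upwards [ae_restrict_mem measurableSet_Ioi] with u hu
      have hu' : t < u := hu
      rw [Real.norm_of_nonneg (div_nonneg (Real.exp_pos _).le (ht.trans hu').le)]
      gcongr
  have htendsto : Tendsto (fun u : ℝ => Real.log u * Real.exp (-u)) atTop (𝓝 0) := by
    have h := Real.tendsto_pow_mul_exp_neg_atTop_nhds_zero 1
    simp only [pow_one] at h
    refine tendsto_of_tendsto_of_tendsto_of_le_of_le' tendsto_const_nhds h ?_ ?_
    · filter_upwards [eventually_ge_atTop 1] with u hu
      exact mul_nonneg (Real.log_nonneg hu) (Real.exp_pos _).le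
    · filter_upwards [eventually_ge_atTop 0] with u hu
      gcongr
      exact Real.log_le_self hu
  have hftc := integral_Ioi_of_hasDerivAt_of_tendsto'
    (f' := fun u : ℝ => Real.exp (-u) / u - Real.log u * Real.exp (-u))
    (fun u hu => ?_) (hdiv.sub hlog) htendsto
  · rw [integral_sub hdiv hlog] at hftc
    linarith
  · have hu0 : u ≠ 0 := (ht.trans_le hu).ne'
    refine ((Real.hasDerivAt_log hu0).mul (hasDerivAt_neg u).exp).congr_deriv ?_
    field_simp
    ring

lemma summable_expInt_one_series (t : ℝ) :
    Summable (fun j : ℕ =>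
      (-1 : ℝ) ^ j * t ^ (j + 1) / ((j + 1) * Nat.factorial (j + 1))) := by
  refine Summable.of_norm_bounded
    ((summable_nat_add_iff 1).2 (Real.summable_pow_div_factorial |t|)) fun j => ?_
  rw [norm_div, norm_mul, norm_pow, norm_pow, norm_neg, norm_one, one_pow, one_mul,
    Real.norm_eq_abs, Real.norm_of_nonneg (by positivity)]
  gcongr
  exact le_mul_of_one_le_left (by positivity) (by linarith [j.cast_nonneg (α := ℝ)])

lemma tsum_neg_one_pow_mul_pow_div_factorial_succ {u : ℝ} (hu : u ≠ 0) :
    ∑' j : ℕ, (-1 : ℝ) ^ j * u ^ j / Nat.factorial (j + 1) = (1 - Real.exp (-u)) / u := by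
  have h := NormedSpace.expSeries_div_hasSum_exp (-u)
  rw [← Real.exp_eq_exp_ℝ, ← hasSum_nat_add_iff' 1] at h
  convert (h.mul_left (-u⁻¹)).tsum_eq using 1
  · congr 1
    ext j
    rw [pow_succ, neg_pow u]
    field_simp
  · simp
    field_simp
    ring

lemma hasDerivAt_expInt_one_series (u : ℝ) :
    HasDerivAt (fun x : ℝ => ∑' j : ℕ,
        (-1 : ℝ) ^ j * x ^ (j + 1) / ((j + 1) * Nat.factorial (j + 1)))
      (∑' j : ℕ, (-1 : ℝ) ^ j * u ^ j / Nat.factorial (j + 1)) u := by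
  have hmem : u ∈ Ioo (-(|u| + 1)) (|u| + 1) := abs_lt.1 (lt_add_one |u|)
  refine hasDerivAt_tsum_of_isPreconnected
    (g := fun (j : ℕ) (x : ℝ) => (-1 : ℝ) ^ j * x ^ (j + 1) / ((j + 1) * Nat.factorial (j + 1)))
    (g' := fun (j : ℕ) (x : ℝ) => (-1 : ℝ) ^ j * x ^ j / Nat.factorial (j + 1))
    (Real.summable_pow_div_factorial (|u| + 1)) isOpen_Ioo isPreconnected_Ioo
    (fun j y _ => ?_) (fun j y hy => ?_) hmem (summable_expInt_one_series u) hmem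
  · refine (((hasDerivAt_pow (j + 1) y).const_mul ((-1 : ℝ) ^ j)).div_const
      ((j + 1) * Nat.factorial (j + 1) : ℝ)).congr_deriv ?_
    push_cast
    field_simp
  · rw [norm_div, norm_mul, norm_pow, norm_pow, norm_neg, norm_one, one_pow, one_mul,
      Real.norm_eq_abs, Real.norm_of_nonneg (by positivity)]
    have hy' : |y| ≤ |u| + 1 := (abs_lt.2 hy).le
    have hfac : (Nat.factorial j : ℝ) ≤ Nat.factorial (j + 1) := by
      exact_mod_cast Nat.factorial_le j.le_succ
    gcongr

lemma continuousOn_one_sub_exp_neg_mul_log :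
    ContinuousOn (fun u : ℝ => (1 - Real.exp (-u)) * Real.log u) (Ici 0) := by
  intro u hu
  rcases (mem_Ici.1 hu).eq_or_lt with rfl | hu0
  · have h : Tendsto (fun u : ℝ => |u * Real.log u|) (𝓝[Ici 0] 0) (𝓝 0) := by
      have := (Real.continuous_mul_log.abs.tendsto 0).mono_left
        (nhdsWithin_le_nhds (s := Ici 0))
      simpa using this
    rw [ContinuousWithinAt, Real.log_zero, mul_zero]
    refine squeeze_zero_norm' ?_ h
    filter_upwards [self_mem_nhdsWithin] with x hx
    have hx0 : (0 : ℝ) ≤ x := hx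
    rw [Real.norm_eq_abs, abs_mul, abs_mul, abs_of_nonneg hx0,
      abs_of_nonneg (sub_nonneg.2 (Real.exp_le_one_iff.2 (neg_nonpos.2 hx0)))]
    gcongr
    linarith [Real.add_one_le_exp (-x)]
  · exact ((by fun_prop : ContinuousAt (fun u : ℝ => 1 - Real.exp (-u)) u).mul
      (Real.continuousAt_log hu0.ne')).continuousWithinAt

lemma integral_log_mul_exp_neg {t : ℝ} (ht : 0 < t) :
    ∫ u in (0 : ℝ)..t, Real.log u * Real.exp (-u) = (1 - Real.exp (-t)) * Real.log t -
      ∑' j : ℕ, (-1 : ℝ) ^ j * t ^ (j + 1) / ((j + 1) * Nat.factorial (j + 1)) := by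
  have hint : IntervalIntegrable (fun u : ℝ => Real.log u * Real.exp (-u)) volume 0 t :=
    (intervalIntegrable_iff_integrableOn_Ioc_of_le ht.le).2
      (integrableOn_Ioi_log_mul_exp_neg.mono_set Ioc_subset_Ioi_self)
  rw [intervalIntegral.integral_eq_sub_of_hasDerivAt_of_le
    (f := fun u : ℝ => (1 - Real.exp (-u)) * Real.log u -
      ∑' j : ℕ, (-1 : ℝ) ^ j * u ^ (j + 1) / ((j + 1) * Nat.factorial (j + 1)))
    ht.le ?_ (fun u hu => ?_) hint]
  · simp
  · exact (continuousOn_one_sub_exp_neg_mul_log.mono Icc_subset_Ici_self).sub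
      fun u _ => (hasDerivAt_expInt_one_series u).continuousAt.continuousWithinAt
  · have hu0 : u ≠ 0 := hu.1.ne'
    refine ((((hasDerivAt_neg u).exp.const_sub 1).mul (Real.hasDerivAt_log hu0)).sub
      (hasDerivAt_expInt_one_series u)).congr_deriv ?_
    rw [tsum_neg_one_pow_mul_pow_div_factorial_succ hu0]
    field_simp
    ring

/-- For every `t > 0`, the exponential integral `E₁` admits the convergent series expansion
`E₁(t) = −γ − log t + Σ_{k=1}^∞ (−1)^{k+1} t^k / (k·k!)`, where `γ` is the Euler–Mascheroni
constant.  (The series is indexed here by `k = j + 1`, `j : ℕ`, so that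
`(−1)^{k+1} = (−1)^j`.) -/
theorem expInt_one_series (t : ℝ) (ht : 0 < t) :
    Summable (fun j : ℕ =>
      (-1 : ℝ) ^ j * t ^ (j + 1) / ((j + 1) * Nat.factorial (j + 1)))
    ∧ expInt 1 t
        = -Real.eulerMascheroniConstant - Real.log t
          + ∑' j : ℕ, (-1 : ℝ) ^ j * t ^ (j + 1) / ((j + 1) * Nat.factorial (j + 1)) := by
  refine ⟨summable_expInt_one_series t, ?_⟩
  rw [expInt_one_eq_integral_Ioi ht, integral_Ioi_exp_neg_div ht]
  have h := intervalIntegral.integral_Ioi_sub_Ioi integrableOn_Ioi_log_mul_exp_neg ht.le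
  rw [integral_Ioi_log_mul_exp_neg, integral_log_mul_exp_neg ht] at h
  linarith
end

section
/- Let κ > 0, Z > 0, Q⁰ ∈ ℝ, let f : [0, Z] → ℝ be continuous, and let I(τ, μ) be defined by the Duhamel formula with incoming data g(μ) = μ Q⁰ at τ = 0 and zero incoming data at τ = Z: I(τ, μ) = e^{−κτ/μ} μ Q⁰ + ∫₀^τ e^{−κ(τ−t)/μ} (κ/μ) f(t) dt for μ ∈ (0, 1], and I(τ, μ) = ∫_τ^Z e^{−κ(t−τ)/|μ|} (κ/|μ|) f(t) dt for μ ∈ [−1, 0). Then the angular average J(τ) := ½∫₋₁¹ I(τ, μ) dμ satisfies J(τ) = ½ Q⁰ E₃(κτ) + (κ/2) ∫₀^Z E₁(κ|τ − t|) f(t) dt for every τ ∈ (0, Z). -/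
open MeasureTheory Real intervalIntegral

theorem expInt_one_eq (X : ℝ) :
    expInt 1 X = ∫ μ in Set.Ioo (0 : ℝ) 1, Real.exp (-X / μ) * μ⁻¹ := by
  refine setIntegral_congr_fun measurableSet_Ioo fun μ _ => ?_
  have h : ((1 : ℕ) : ℝ) - 2 = -1 := by norm_num
  simp only [h, Real.rpow_neg_one]

theorem expInt_three_eq (X : ℝ) :
    expInt 3 X = ∫ μ in Set.Ioo (0 : ℝ) 1, Real.exp (-X / μ) * μ := by
  refine setIntegral_congr_fun measurableSet_Ioo fun μ _ => ?_
  have h : ((3 : ℕ) : ℝ) - 2 = 1 := by norm_num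
  simp only [h, Real.rpow_one]

theorem integral_attenuation_kernel (κ μ S : ℝ) :
    ∫ s in (0 : ℝ)..S, Real.exp (-κ * s / μ) * (κ / μ) = 1 - Real.exp (-κ * S / μ) := by
  have hd : ∀ s ∈ Set.uIcc 0 S, HasDerivAt (fun s => -Real.exp (-κ * s / μ))
      (Real.exp (-κ * s / μ) * (κ / μ)) s := fun s _ => by
    have h : HasDerivAt (fun s : ℝ => -κ * s / μ) (-κ * 1 / μ) s :=
      ((hasDerivAt_id s).const_mul (-κ)).div_const μ
    exact h.exp.neg.congr_deriv (by ring)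
  rw [integral_eq_sub_of_hasDerivAt hd (Continuous.intervalIntegrable (by fun_prop) _ _)]
  simp
  ring

theorem integrable_attenuation_kernel_mul {κ S : ℝ} (hκ : 0 < κ) (hS : 0 ≤ S) {h : ℝ → ℝ}
    (hh : ContinuousOn h (Set.Icc 0 S)) :
    Integrable (fun p : ℝ × ℝ => Real.exp (-κ * p.2 / p.1) * (κ / p.1) * h p.2)
      ((volume.restrict (Set.Ioo 0 1)).prod (volume.restrict (Set.Ioc 0 S))) := by
  obtain ⟨M, hM⟩ := isCompact_Icc.exists_bound_of_continuousOn hh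
  have hM0 : 0 ≤ M := (norm_nonneg _).trans (hM 0 ⟨le_rfl, hS⟩)
  have hmeas : AEStronglyMeasurable
      (fun p : ℝ × ℝ => Real.exp (-κ * p.2 / p.1) * (κ / p.1) * h p.2)
      ((volume.restrict (Set.Ioo 0 1)).prod (volume.restrict (Set.Ioc 0 S))) := by
    rw [Measure.prod_restrict]
    refine ContinuousOn.aestronglyMeasurable ?_ (measurableSet_Ioo.prod measurableSet_Ioc)
    have hne : ∀ p ∈ Set.Ioo (0 : ℝ) 1 ×ˢ Set.Ioc (0 : ℝ) S, p.1 ≠ 0 :=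
      fun p hp => hp.1.1.ne'
    refine ContinuousOn.mul (ContinuousOn.mul ?_ ?_) ?_
    · exact ((continuousOn_const.mul continuousOn_snd).div continuousOn_fst hne).rexp
    · exact continuousOn_const.div continuousOn_fst hne
    · exact hh.comp continuousOn_snd fun p hp => Set.Ioc_subset_Icc_self hp.2
  have hfib : ∀ μ : ℝ, IntegrableOn
      (fun s => Real.exp (-κ * s / μ) * (κ / μ) * h s) (Set.Ioc 0 S) := fun μ =>
    ((ContinuousOn.mul (Continuous.continuousOn (by fun_prop)) hh).integrableOn_Icc).mono_set
      Set.Ioc_subset_Icc_self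
  rw [integrable_prod_iff hmeas]
  refine ⟨ae_of_all _ hfib, Integrable.of_bound hmeas.norm.integral_prod_right' M ?_⟩
  filter_upwards [ae_restrict_mem measurableSet_Ioo] with μ hμ
  have hk : IntegrableOn (fun s => Real.exp (-κ * s / μ) * (κ / μ) * M) (Set.Ioc 0 S) :=
    (Continuous.integrableOn_Icc (by fun_prop)).mono_set Set.Ioc_subset_Icc_self
  rw [Real.norm_of_nonneg (integral_nonneg fun _ => norm_nonneg _)]
  calc ∫ s in Set.Ioc 0 S, ‖Real.exp (-κ * s / μ) * (κ / μ) * h s‖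
      ≤ ∫ s in Set.Ioc 0 S, Real.exp (-κ * s / μ) * (κ / μ) * M := by
        refine setIntegral_mono_on (hfib μ).norm hk measurableSet_Ioc fun s hs => ?_
        have h0 : 0 ≤ Real.exp (-κ * s / μ) * (κ / μ) :=
          mul_nonneg (Real.exp_pos _).le (div_pos hκ hμ.1).le
        rw [norm_mul, Real.norm_of_nonneg h0]
        exact mul_le_mul_of_nonneg_left (hM s (Set.Ioc_subset_Icc_self hs)) h0
    _ = (1 - Real.exp (-κ * S / μ)) * M := by
        rw [← integral_attenuation_kernel, integral_of_le hS, MeasureTheory.integral_mul_const]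
    _ ≤ M := mul_le_of_le_one_left hM0 (by linarith [Real.exp_pos (-κ * S / μ)])

theorem integral_attenuation_kernel_mul_left (κ s y : ℝ) :
    ∫ μ in Set.Ioo (0 : ℝ) 1, Real.exp (-κ * s / μ) * (κ / μ) * y
      = κ * (expInt 1 (κ * s) * y) := by
  rw [MeasureTheory.integral_mul_const, expInt_one_eq, ← mul_assoc,
    ← MeasureTheory.integral_const_mul]
  congr 1
  refine integral_congr_ae (ae_of_all _ fun μ => ?_)
  simp only [neg_mul]
  ring

theorem intervalIntegrable_expInt_one_mul {κ S : ℝ} (hκ : 0 < κ) (hS : 0 ≤ S) {h : ℝ → ℝ}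
    (hh : ContinuousOn h (Set.Icc 0 S)) :
    IntervalIntegrable (fun s => expInt 1 (κ * s) * h s) volume 0 S := by
  rw [intervalIntegrable_iff_integrableOn_Ioc_of_le hS]
  have h1 := (integrable_attenuation_kernel_mul hκ hS hh).integral_prod_right
  simp only [integral_attenuation_kernel_mul_left] at h1
  simpa [IntegrableOn, hκ.ne'] using h1.const_mul κ⁻¹

theorem integrableOn_integral_attenuation_kernel_mul {κ S : ℝ} (hκ : 0 < κ) (hS : 0 ≤ S)
    {h : ℝ → ℝ} (hh : ContinuousOn h (Set.Icc 0 S)) :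
    IntegrableOn (fun μ => ∫ s in (0 : ℝ)..S, Real.exp (-κ * s / μ) * (κ / μ) * h s)
      (Set.Ioo 0 1) := by
  simp only [integral_of_le hS]
  exact (integrable_attenuation_kernel_mul hκ hS hh).integral_prod_left

theorem integral_integral_attenuation_kernel_mul {κ S : ℝ} (hκ : 0 < κ) (hS : 0 ≤ S)
    {h : ℝ → ℝ} (hh : ContinuousOn h (Set.Icc 0 S)) :
    ∫ μ in Set.Ioo (0 : ℝ) 1, ∫ s in (0 : ℝ)..S, Real.exp (-κ * s / μ) * (κ / μ) * h s
      = κ * ∫ s in (0 : ℝ)..S, expInt 1 (κ * s) * h s := by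
  simp only [integral_of_le hS]
  rw [integral_integral_swap (integrable_attenuation_kernel_mul hκ hS hh)]
  simp only [integral_attenuation_kernel_mul_left, MeasureTheory.integral_const_mul]

theorem integrableOn_exp_mul_incoming {a : ℝ} (ha : 0 ≤ a) (Q : ℝ) :
    IntegrableOn (fun μ : ℝ => Real.exp (-a / μ) * (μ * Q)) (Set.Ioo 0 1) := by
  refine IntegrableOn.of_bound (by simp) (Measurable.aestronglyMeasurable (by fun_prop)) |Q| ?_
  filter_upwards [ae_restrict_mem measurableSet_Ioo] with μ hμ
  have h1 : Real.exp (-a / μ) ≤ 1 :=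
    Real.exp_le_one_iff.2 (div_nonpos_of_nonpos_of_nonneg (neg_nonpos.2 ha) hμ.1.le)
  rw [Real.norm_eq_abs, abs_mul, abs_mul, Real.abs_exp, abs_of_pos hμ.1]
  exact (mul_le_of_le_one_left (mul_nonneg hμ.1.le (abs_nonneg Q)) h1).trans
    (mul_le_of_le_one_left (abs_nonneg Q) hμ.2.le)

/-- **Angular average of the Duhamel formula.**  Let `κ > 0`, `Z > 0`, `Q⁰ ∈ ℝ`,
`f : [0,Z] → ℝ` continuous, and let `I(τ,μ)` be given by the Duhamel formula with incoming
data `g(μ) = μQ⁰` at `τ = 0` and zero incoming data at `τ = Z`.  Then the angular average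
`J(τ) = ½∫₋₁¹ I(τ,μ)dμ` satisfies
`J(τ) = ½Q⁰E₃(κτ) + (κ/2)∫₀^Z E₁(κ|τ−t|)f(t)dt` for every `τ ∈ (0,Z)`. -/
theorem duhamel_angular_average
    (κ Z Q0 : ℝ) (hκ : 0 < κ) (hZ : 0 < Z)
    (f : ℝ → ℝ) (hf : ContinuousOn f (Set.Icc 0 Z))
    (I : ℝ → ℝ → ℝ)
    (hI : ∀ τ μ, I τ μ =
      if 0 < μ then
        Real.exp (-κ * τ / μ) * (μ * Q0)
          + ∫ t in (0 : ℝ)..τ, Real.exp (-κ * (τ - t) / μ) * (κ / μ) * f t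
      else
        ∫ t in τ..Z, Real.exp (-κ * (t - τ) / |μ|) * (κ / |μ|) * f t) :
    ∀ τ ∈ Set.Ioo (0 : ℝ) Z,
      (1 / 2) * (∫ μ in Set.Ioo (-1 : ℝ) 1, I τ μ)
        = (1 / 2) * Q0 * expInt 3 (κ * τ)
          + (κ / 2) * ∫ t in (0 : ℝ)..Z, expInt 1 (κ * |τ - t|) * f t := by

  rintro τ ⟨hτ0, hτZ⟩
  have hl : ContinuousOn (fun s => f (τ - s)) (Set.Icc 0 τ) :=
    hf.comp (by fun_prop) fun s hs => ⟨by linarith [hs.2], by linarith [hs.1]⟩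
  have hr : ContinuousOn (fun s => f (τ + s)) (Set.Icc 0 (Z - τ)) :=
    hf.comp (by fun_prop) fun s hs => ⟨by linarith [hs.1], by linarith [hs.2]⟩
  have hS : 0 ≤ Z - τ := by linarith
  have hpos : ∀ μ ∈ Set.Ioo (0 : ℝ) 1, I τ μ = Real.exp (-(κ * τ) / μ) * (μ * Q0)
      + ∫ s in (0 : ℝ)..τ, Real.exp (-κ * s / μ) * (κ / μ) * f (τ - s) := fun μ hμ => by
    rw [hI, if_pos hμ.1, neg_mul]
    congr 1
    simpa using integral_comp_sub_left (a := 0) (b := τ)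
      (fun s => Real.exp (-κ * s / μ) * (κ / μ) * f (τ - s)) τ
  have hneg : ∀ μ ∈ Set.Ioo (0 : ℝ) 1, I τ (-μ) =
      ∫ s in (0 : ℝ)..(Z - τ), Real.exp (-κ * s / μ) * (κ / μ) * f (τ + s) := fun μ hμ => by
    rw [hI, if_neg (by linarith [hμ.1]), abs_neg, abs_of_pos hμ.1]
    simpa using integral_comp_sub_right (a := τ) (b := Z)
      (fun s => Real.exp (-κ * s / μ) * (κ / μ) * f (τ + s)) τ
  have hincoming := integrableOn_exp_mul_incoming (mul_pos hκ hτ0).le Q0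
  have hleft := integrableOn_integral_attenuation_kernel_mul hκ hτ0.le hl
  have hright := integrableOn_integral_attenuation_kernel_mul hκ hS hr
  have hIpos : IntervalIntegrable (I τ) volume 0 1 := by
    rw [intervalIntegrable_iff_integrableOn_Ioo_of_le zero_le_one]
    exact (hincoming.add hleft).congr_fun (fun μ hμ => (hpos μ hμ).symm) measurableSet_Ioo
  have hIneg : IntervalIntegrable (I τ) volume (-1) 0 := by
    have h : IntervalIntegrable (fun μ => I τ (-μ)) volume 0 1 := by
      rw [intervalIntegrable_iff_integrableOn_Ioo_of_le zero_le_one]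
      exact hright.congr_fun (fun μ hμ => (hneg μ hμ).symm) measurableSet_Ioo
    simpa using (h.comp_sub_left 0).symm
  have hsplit : ∫ μ in Set.Ioo (-1 : ℝ) 1, I τ μ
      = (∫ μ in Set.Ioo (0 : ℝ) 1, I τ (-μ)) + ∫ μ in Set.Ioo (0 : ℝ) 1, I τ μ := by
    simp only [← integral_Ioc_eq_integral_Ioo]
    rw [← integral_of_le (by norm_num), ← integral_of_le zero_le_one,
      ← integral_of_le zero_le_one, ← integral_add_adjacent_intervals hIneg hIpos,
      integral_comp_neg (I τ), neg_zero]
  have hEl : Set.EqOn (fun t => expInt 1 (κ * (τ - t)) * f (τ - (τ - t)))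
      (fun t => expInt 1 (κ * |τ - t|) * f t) (Set.uIcc 0 τ) := fun t ht => by
    rw [Set.uIcc_of_le hτ0.le] at ht
    simp only [sub_sub_cancel, abs_of_nonneg (sub_nonneg.2 ht.2)]
  have hEr : Set.EqOn (fun t => expInt 1 (κ * (t - τ)) * f (τ + (t - τ)))
      (fun t => expInt 1 (κ * |τ - t|) * f t) (Set.uIcc τ Z) := fun t ht => by
    rw [Set.uIcc_of_le hτZ.le] at ht
    simp only [add_sub_cancel, abs_sub_comm τ t, abs_of_nonneg (sub_nonneg.2 ht.1)]
  have hJl : IntervalIntegrable (fun t => expInt 1 (κ * |τ - t|) * f t) volume 0 τ := by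
    have h := ((intervalIntegrable_expInt_one_mul hκ hτ0.le hl).comp_sub_left τ).symm
    simp only [sub_self, sub_zero] at h
    exact h.congr (hEl.mono Set.uIoc_subset_uIcc)
  have hJr : IntervalIntegrable (fun t => expInt 1 (κ * |τ - t|) * f t) volume τ Z := by
    have h := (intervalIntegrable_expInt_one_mul hκ hS hr).comp_sub_right τ
    simp only [zero_add, sub_add_cancel] at h
    exact h.congr (hEr.mono Set.uIoc_subset_uIcc)
  have hin : ∫ μ in Set.Ioo (0 : ℝ) 1, Real.exp (-(κ * τ) / μ) * (μ * Q0)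
      = Q0 * expInt 3 (κ * τ) := by
    simp only [expInt_three_eq, ← mul_assoc, MeasureTheory.integral_mul_const, mul_comm Q0]
  rw [hsplit, setIntegral_congr_fun measurableSet_Ioo hneg,
    setIntegral_congr_fun measurableSet_Ioo hpos, integral_add hincoming hleft, hin,
    integral_integral_attenuation_kernel_mul hκ hτ0.le hl,
    integral_integral_attenuation_kernel_mul hκ hS hr,
    ← integral_add_adjacent_intervals hJl hJr, ← integral_congr hEl, ← integral_congr hEr,
    integral_comp_sub_left (fun s => expInt 1 (κ * s) * f (τ - s)),
    integral_comp_sub_right (fun s => expInt 1 (κ * s) * f (τ + s)), sub_self, sub_zero]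
  ring
end
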